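/- For every n ≥ 1 and every t ∈ (0,1), the function t ↦ E[log Z_t] is differentiable and (1/n)·(d/dt) E[log Z_t] ≥ −m²/(4Δ). -/

import Mathlib

open MeasureTheory ProbabilityTheory Filter Real

noncomputable section

/-- Index set of pairs `1 ≤ i ≤ j ≤ n`. -/
abbrev SymIdx (n : ℕ) := {q : Fin n × Fin n // q.1 ≤ q.2}

/-- The interpolating Hamiltonian `H_t(x)` given the quenched variables
`x*` (the signal), `ξ` (matrix noise) and `z` (vector noise). -/
def Ham (Δ m : ℝ) (n : ℕ) (t : ℝ)
    (xs : Fin n → ℝ) (ξ : SymIdx n → ℝ) (z : Fin n → ℝ) (x : Fin n → ℝ) : ℝ :=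
  (∑ q : SymIdx n,
      (-(t * x q.1.1 ^ 2 * x q.1.2 ^ 2) / (2 * Δ * n)
        + t * x q.1.1 * x q.1.2 * xs q.1.1 * xs q.1.2 / (Δ * n)
        + Real.sqrt (t / (n * Δ)) * x q.1.1 * x q.1.2 * ξ q))
    - (1 - t) * m * (∑ i, x i ^ 2) / (2 * Δ)
    + (1 - t) * m * (∑ i, x i * xs i) / Δ
    + Real.sqrt (m * (1 - t) / Δ) * (∑ i, x i * z i)

/-- The interpolating partition function `Z_t`. -/
def Zt (p : Measure ℝ) (Δ m : ℝ) (n : ℕ) (t : ℝ)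
    (xs : Fin n → ℝ) (ξ : SymIdx n → ℝ) (z : Fin n → ℝ) : ℝ :=
  ∫ x, Real.exp (Ham Δ m n t xs ξ z x) ∂(Measure.pi fun _ : Fin n => p)

/-- The Gibbs expectation `⟨f⟩_t` under the interpolating Gibbs measure. -/
def gibbs (p : Measure ℝ) (Δ m : ℝ) (n : ℕ) (t : ℝ)
    (xs : Fin n → ℝ) (ξ : SymIdx n → ℝ) (z : Fin n → ℝ) (f : (Fin n → ℝ) → ℝ) : ℝ :=
  (∫ x, f x * Real.exp (Ham Δ m n t xs ξ z x) ∂(Measure.pi fun _ : Fin n => p))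
    / Zt p Δ m n t xs ξ z

/-- The law of the quenched variables `(x*, ξ, z)` : coordinates of `x*` are i.i.d. `p`,
and `ξ`, `z` are i.i.d. standard Gaussians, all independent. -/
def baseP (p : Measure ℝ) (n : ℕ) :
    Measure ((Fin n → ℝ) × (SymIdx n → ℝ) × (Fin n → ℝ)) :=
  (Measure.pi fun _ : Fin n => p).prod
    ((Measure.pi fun _ : SymIdx n => gaussianReal 0 1).prod
      (Measure.pi fun _ : Fin n => gaussianReal 0 1))

/-- The averaged log-partition function `t ↦ E[log Z_t]`. -/
def Favg (p : Measure ℝ) (Δ m : ℝ) (n : ℕ) (t : ℝ) : ℝ :=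
  ∫ ω, Real.log (Zt p Δ m n t ω.1 ω.2.1 ω.2.2) ∂(baseP p n)

section GaussianShift

variable {κ : Type*} [Fintype κ]

/-- The standard Gaussian measure on `κ → ℝ`. -/
abbrev stdGaussianPi (κ : Type*) [Fintype κ] : Measure (κ → ℝ) :=
  Measure.pi fun _ : κ => gaussianReal 0 1

/-- The likelihood ratio between the standard Gaussian shifted by `v` and the standard Gaussian. -/
def gaussLR (v y : κ → ℝ) : ℝ := Real.exp (∑ k, v k * y k - (∑ k, v k ^ 2) / 2)

lemma gaussLR_pos (v y : κ → ℝ) : 0 < gaussLR v y := Real.exp_pos _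

@[fun_prop]
lemma continuous_gaussLR (v : κ → ℝ) : Continuous (gaussLR v) := by
  unfold gaussLR; fun_prop

lemma gaussianReal_map_add_eq_withDensity (a : ℝ) :
    (gaussianReal 0 1).map (· + a)
      = (gaussianReal 0 1).withDensity fun y => ENNReal.ofReal (Real.exp (a * y - a ^ 2 / 2)) := by
  rw [gaussianReal_map_add_const, gaussianReal_of_var_ne_zero _ one_ne_zero,
    gaussianReal_of_var_ne_zero _ one_ne_zero, ← withDensity_mul _ (by fun_prop) (by fun_prop)]
  congr 1
  ext y
  simp only [gaussianPDF, Pi.mul_apply, gaussianPDFReal]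
  rw [← ENNReal.ofReal_mul (by positivity), mul_assoc _ (Real.exp _) (Real.exp _), ← Real.exp_add]
  congr 3
  simp
  ring

lemma integrable_exp_linear_gaussianReal (a b : ℝ) :
    Integrable (fun y => Real.exp (a * y - b)) (gaussianReal 0 1) := by
  simp_rw [Real.exp_sub]
  exact (integrable_exp_mul_gaussianReal a).div_const _

lemma gaussLR_eq_prod (v y : κ → ℝ) :
    gaussLR v y = ∏ k, Real.exp (v k * y k - v k ^ 2 / 2) := by
  rw [gaussLR, ← Real.exp_sum, Finset.sum_sub_distrib, Finset.sum_div]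

lemma stdGaussianPi_map_add (v : κ → ℝ) :
    (stdGaussianPi κ).map (· + v)
      = (stdGaussianPi κ).withDensity fun y => ENNReal.ofReal (gaussLR v y) := by
  have h1 : (stdGaussianPi κ).map (· + v)
      = Measure.pi fun k => (gaussianReal 0 1).map (· + v k) := by
    have : ∀ k, SigmaFinite ((gaussianReal 0 1).map (· + v k)) := fun k => by
      rw [gaussianReal_map_add_const]; infer_instance
    exact Measure.pi_map_pi (f := fun k (y : ℝ) => y + v k) fun k => by fun_prop
  have : ∀ k, SigmaFinite ((gaussianReal 0 1).map (· + v k)) := fun k => by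
    rw [gaussianReal_map_add_const]; infer_instance
  rw [h1]
  refine Measure.pi_eq fun s hs => ?_
  rw [withDensity_apply _ (MeasurableSet.univ_pi hs), stdGaussianPi, Measure.restrict_pi_pi]
  have hint : ∀ k, Integrable (fun y => Real.exp (v k * y - v k ^ 2 / 2))
      ((gaussianReal 0 1).restrict (s k)) := fun k =>
    (integrable_exp_linear_gaussianReal _ _).restrict
  simp_rw [gaussLR_eq_prod]
  rw [← ofReal_integral_eq_lintegral_ofReal (Integrable.fintype_prod hint)
    (.of_forall fun y => by positivity),
    integral_fintype_prod_eq_prod (fun k y => Real.exp (v k * y - v k ^ 2 / 2)),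
    ENNReal.ofReal_prod_of_nonneg fun k _ => integral_nonneg fun y => by positivity]
  refine Finset.prod_congr rfl fun k _ => ?_
  rw [gaussianReal_map_add_eq_withDensity, withDensity_apply _ (hs k),
    ofReal_integral_eq_lintegral_ofReal (hint k) (.of_forall fun y => by positivity)]

lemma integral_stdGaussianPi_add (v : κ → ℝ) (f : (κ → ℝ) → ℝ) :
    ∫ y, f (y + v) ∂(stdGaussianPi κ) = ∫ y, gaussLR v y * f y ∂(stdGaussianPi κ) := by
  have h := (MeasurableEquiv.addRight v).measurableEmbedding.integral_map
    (μ := stdGaussianPi κ) f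
  simp only [MeasurableEquiv.coe_addRight] at h
  rw [← h, stdGaussianPi_map_add, integral_withDensity_eq_integral_toReal_smul
    (by fun_prop) (by simp)]
  simp [ENNReal.toReal_ofReal (gaussLR_pos _ _).le]

lemma integral_gaussLR (v : κ → ℝ) : ∫ y, gaussLR v y ∂(stdGaussianPi κ) = 1 := by
  simpa using (integral_stdGaussianPi_add v fun _ => 1).symm

lemma integrable_exp_sum_abs (B : ℝ) :
    Integrable (fun y : κ → ℝ => Real.exp (B * ∑ k, |y k|)) (stdGaussianPi κ) := by
  have h : ∀ _ : κ, Integrable (fun y : ℝ => Real.exp (B * |y|)) (gaussianReal 0 1) := fun _ =>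
    integrable_exp_mul_abs (integrable_exp_mul_gaussianReal B)
      (integrable_exp_mul_gaussianReal (-B))
  simpa only [Finset.mul_sum, Real.exp_sum] using Integrable.fintype_prod h

lemma integrable_of_abs_le_exp {f : (κ → ℝ) → ℝ} (hf : Continuous f) {A B : ℝ}
    (h : ∀ y, |f y| ≤ A * Real.exp (B * ∑ k, |y k|)) : Integrable f (stdGaussianPi κ) :=
  ((integrable_exp_sum_abs B).const_mul A).mono' hf.aestronglyMeasurable (.of_forall h)

lemma abs_sum_mul_le {v y : κ → ℝ} {C : ℝ} (hv : ∀ k, |v k| ≤ C) :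
    |∑ k, v k * y k| ≤ C * ∑ k, |y k| := by
  rw [Finset.mul_sum]
  refine (Finset.abs_sum_le_sum_abs _ _).trans (Finset.sum_le_sum fun k _ => ?_)
  rw [abs_mul]
  exact mul_le_mul_of_nonneg_right (hv k) (abs_nonneg _)

lemma gaussLR_le {v : κ → ℝ} {C : ℝ} (hv : ∀ k, |v k| ≤ C) (y : κ → ℝ) :
    gaussLR v y ≤ Real.exp (C * ∑ k, |y k|) := by
  refine Real.exp_le_exp.2 ?_
  have h1 := (abs_le.1 (abs_sum_mul_le (y := y) hv)).2
  have h2 : 0 ≤ ∑ k, v k ^ 2 := by positivity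
  linarith

lemma hasDerivAt_gaussLR {u : ℝ → κ → ℝ} {u' : κ → ℝ} {s : ℝ}
    (hu : ∀ k, HasDerivAt (fun r => u r k) (u' k) s) (y : κ → ℝ) :
    HasDerivAt (fun r => gaussLR (u r) y)
      ((∑ k, u' k * y k - ∑ k, u s k * u' k) * gaussLR (u s) y) s := by
  have h1 : HasDerivAt (fun r => ∑ k, u r k * y k) (∑ k, u' k * y k) s :=
    HasDerivAt.fun_sum fun k _ => (hu k).mul_const _
  have h2 : HasDerivAt (fun r => ∑ k, u r k ^ 2) (∑ k, 2 * u s k * u' k) s :=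
    HasDerivAt.fun_sum fun k _ => by simpa using! (hu k).pow 2
  refine ((h1.sub (h2.div_const 2)).exp).congr_deriv ?_
  have h3 : (∑ k, 2 * u s k * u' k) / 2 = ∑ k, u s k * u' k := by
    rw [Finset.sum_div]; exact Finset.sum_congr rfl fun k _ => by ring
  rw [h3, mul_comm]
  rfl

/-- Directional Gaussian integration by parts for functions of exponential growth. -/
lemma integral_linear_mul_eq_integral_deriv {f f' : (κ → ℝ) → ℝ} {v : κ → ℝ} {A B : ℝ}
    (hf : Continuous f) (hf' : Continuous f')
    (hd : ∀ y, HasDerivAt (fun s : ℝ => f (y + s • v)) (f' y) 0)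
    (hB : 0 ≤ B)
    (hfb : ∀ y, |f y| ≤ A * Real.exp (B * ∑ k, |y k|))
    (hfb' : ∀ y, |f' y| ≤ A * Real.exp (B * ∑ k, |y k|)) :
    ∫ y, (∑ k, v k * y k) * f y ∂(stdGaussianPi κ) = ∫ y, f' y ∂(stdGaussianPi κ) := by
  obtain ⟨C, hC0, hC⟩ : ∃ C : ℝ, 0 ≤ C ∧ ∀ k, |v k| ≤ C :=
    ⟨∑ k, |v k|, by positivity, fun k =>
      Finset.single_le_sum (f := fun k => |v k|) (fun _ _ => abs_nonneg _) (Finset.mem_univ k)⟩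
  have hA : 0 ≤ A := by
    have h := (abs_nonneg _).trans (hfb 0)
    simpa using h
  have hball : Metric.ball (0 : ℝ) 1 ∈ nhds (0 : ℝ) := Metric.ball_mem_nhds _ one_pos
  have hmem : ∀ s ∈ Metric.ball (0 : ℝ) 1, |s| ≤ 1 := fun s hs => by
    simpa using (Metric.mem_ball.1 hs).le
  have hd' : ∀ y s, HasDerivAt (fun s : ℝ => f (y + s • v)) (f' (y + s • v)) s := fun y s => by
    have h : HasDerivAt (fun r : ℝ => f (y + s • v + r • v)) (f' (y + s • v)) (s - s) := by
      simpa using hd (y + s • v)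
    have := h.comp_sub_const s s
    refine this.congr_of_eventuallyEq (.of_forall fun r => ?_)
    simp only [add_assoc, ← add_smul]
    congr 3; ring
  have hS0 : ∀ y : κ → ℝ, 0 ≤ ∑ k, |y k| := fun y => by positivity
  have hshift := hasDerivAt_integral_of_dominated_loc_of_deriv_le (μ := stdGaussianPi κ)
    (F := fun s y => f (y + s • v)) (F' := fun s y => f' (y + s • v))
    (bound := fun y => A * Real.exp (B * (∑ _k : κ, C)) * Real.exp (B * ∑ k, |y k|)) hball
    (.of_forall fun s => (by fun_prop : Continuous fun y => f (y + s • v)).aestronglyMeasurable)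
    (by simpa using integrable_of_abs_le_exp hf hfb)
    (by fun_prop : Continuous fun y => f' (y + (0 : ℝ) • v)).aestronglyMeasurable
    (.of_forall fun y s hs => by
      refine (hfb' _).trans ?_
      rw [mul_assoc, ← Real.exp_add, ← mul_add, ← Finset.sum_add_distrib]
      gcongr with k
      refine (abs_add_le _ _).trans ?_
      rw [add_comm, Pi.smul_apply, smul_eq_mul, abs_mul]
      have := mul_le_mul (hmem s hs) (hC k) (abs_nonneg _) zero_le_one
      linarith)
    ((integrable_exp_sum_abs B).const_mul _)
    (.of_forall fun y s _ => hd' y s)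
  have htilt := hasDerivAt_integral_of_dominated_loc_of_deriv_le (μ := stdGaussianPi κ)
    (F := fun s y => gaussLR (s • v) y * f y)
    (F' := fun s y => (∑ k, v k * y k - ∑ k, (s • v) k * v k) * gaussLR (s • v) y * f y)
    (bound := fun y => (C + ∑ _k : κ, C * C) * A * Real.exp ((1 + C + B) * ∑ k, |y k|))
    (x₀ := 0) hball
    (.of_forall fun s => (by fun_prop : Continuous _).aestronglyMeasurable)
    (by simpa [gaussLR] using integrable_of_abs_le_exp hf hfb)
    (by fun_prop : Continuous _).aestronglyMeasurable
    (.of_forall fun y s hs => by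
      have hsv : ∀ k, |(s • v) k| ≤ C := fun k => by
        rw [Pi.smul_apply, smul_eq_mul, abs_mul]
        have := mul_le_mul (hmem s hs) (hC k) (abs_nonneg _) zero_le_one
        linarith
      have h1 : |∑ k, v k * y k - ∑ k, (s • v) k * v k|
          ≤ (C + ∑ _k : κ, C * C) * Real.exp (1 * ∑ k, |y k|) := by
        have h2 : |∑ k, (s • v) k * v k| ≤ ∑ _k : κ, C * C :=
          (Finset.abs_sum_le_sum_abs _ _).trans (Finset.sum_le_sum fun k _ => by
            rw [abs_mul]
            exact mul_le_mul (hsv k) (hC k) (abs_nonneg _) hC0)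
        have h3 := abs_sum_mul_le (y := y) hC
        have h4 := Real.add_one_le_exp (∑ k, |y k|)
        have h5 := hS0 y
        have h6 : 0 ≤ ∑ _k : κ, C * C := by positivity
        rw [one_mul]
        refine (abs_sub _ _).trans ?_
        nlinarith
      rw [Real.norm_eq_abs, abs_mul, abs_mul, abs_of_pos (gaussLR_pos _ _)]
      calc _ ≤ (C + ∑ _k : κ, C * C) * Real.exp (1 * ∑ k, |y k|)
            * Real.exp (C * ∑ k, |y k|) * (A * Real.exp (B * ∑ k, |y k|)) := by
            gcongr
            · exact (gaussLR_pos _ _).le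
            · exact gaussLR_le hsv y
            · exact hfb y
        _ = _ := by
            rw [add_mul (1 + C), add_mul 1 C, Real.exp_add, Real.exp_add]; ring)
    ((integrable_exp_sum_abs _).const_mul _)
    (.of_forall fun y s _ =>
      (hasDerivAt_gaussLR (u := fun r : ℝ => r • v) (u' := v)
        (fun k => by simpa using (hasDerivAt_id s).mul_const (v k)) y).mul_const (f y))
  have heq : (fun s : ℝ => ∫ y, f (y + s • v) ∂(stdGaussianPi κ))
      = fun s : ℝ => ∫ y, gaussLR (s • v) y * f y ∂(stdGaussianPi κ) :=
    funext fun s => integral_stdGaussianPi_add _ _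
  have h := hshift.2
  rw [heq] at h
  simpa [gaussLR] using htilt.2.unique h

end GaussianShift

section GaussianMixture

variable {κ ι : Type*} [Fintype κ] [Fintype ι]

/-- The likelihood ratio of a finite mixture of shifted standard Gaussians. -/
def mixLR (w : ι → ℝ) (u : ι → κ → ℝ) (y : κ → ℝ) : ℝ := ∑ x, w x * gaussLR (u x) y

/-- The posterior mean of `g` given the observation `y` in the Gaussian mixture model. -/
def posteriorMean (w : ι → ℝ) (u : ι → κ → ℝ) (g : ι → ℝ) (y : κ → ℝ) : ℝ :=
  (∑ x, w x * gaussLR (u x) y * g x) / mixLR w u y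

variable {w : ι → ℝ} {u : ι → κ → ℝ} {C : ℝ}

@[fun_prop]
lemma continuous_mixLR : Continuous (mixLR w u) := by
  unfold mixLR; fun_prop

lemma mixLR_pos (hw0 : ∀ x, 0 ≤ w x) (hw1 : ∑ x, w x = 1) (y : κ → ℝ) : 0 < mixLR w u y := by
  have h0 : ∀ x ∈ Finset.univ, 0 ≤ w x * gaussLR (u x) y := fun x _ =>
    mul_nonneg (hw0 x) (gaussLR_pos _ _).le
  refine lt_of_le_of_ne (Finset.sum_nonneg h0) fun h => ?_
  have h1 := (Finset.sum_eq_zero_iff_of_nonneg h0).1 h.symm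
  have h2 : ∑ x, w x = 0 := Finset.sum_eq_zero fun x hx =>
    (mul_eq_zero.1 (h1 x hx)).resolve_right (gaussLR_pos _ _).ne'
  linarith

lemma continuous_log_mixLR (hw0 : ∀ x, 0 ≤ w x) (hw1 : ∑ x, w x = 1) :
    Continuous fun y => Real.log (mixLR w u y) :=
  continuous_mixLR.log fun y => (mixLR_pos hw0 hw1 y).ne'

lemma continuous_posteriorMean (hw0 : ∀ x, 0 ≤ w x) (hw1 : ∑ x, w x = 1) (g : ι → ℝ) :
    Continuous (posteriorMean w u g) := by
  unfold posteriorMean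
  exact (by fun_prop : Continuous fun y => ∑ x, w x * gaussLR (u x) y * g x).div
    continuous_mixLR fun y => (mixLR_pos hw0 hw1 y).ne'

lemma abs_posteriorMean_le (hw0 : ∀ x, 0 ≤ w x) (hw1 : ∑ x, w x = 1) {g : ι → ℝ} {D : ℝ}
    (hg : ∀ x, |g x| ≤ D) (y : κ → ℝ) : |posteriorMean w u g y| ≤ D := by
  have hZ := mixLR_pos (u := u) hw0 hw1 y
  rw [posteriorMean, abs_div, abs_of_pos hZ, div_le_iff₀ hZ, mixLR, Finset.mul_sum]
  refine (Finset.abs_sum_le_sum_abs _ _).trans (Finset.sum_le_sum fun x _ => ?_)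
  have h := mul_nonneg (hw0 x) (gaussLR_pos (u x) y).le
  rw [abs_mul, abs_of_nonneg h, mul_comm]
  exact mul_le_mul_of_nonneg_right (hg x) h

lemma abs_gaussLR_mul_posteriorMean_le (hw0 : ∀ x, 0 ≤ w x) (hw1 : ∑ x, w x = 1)
    {a : κ → ℝ} (ha : ∀ k, |a k| ≤ C) {g : ι → ℝ} {D : ℝ} (hD : 0 ≤ D) (hg : ∀ x, |g x| ≤ D)
    (y : κ → ℝ) :
    |gaussLR a y * posteriorMean w u g y| ≤ D * Real.exp (C * ∑ k, |y k|) := by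
  rw [abs_mul, abs_of_pos (gaussLR_pos _ _), mul_comm]
  exact mul_le_mul (abs_posteriorMean_le hw0 hw1 hg y) (gaussLR_le ha y) (gaussLR_pos _ _).le hD

lemma integrable_gaussLR_mul_posteriorMean (hw0 : ∀ x, 0 ≤ w x) (hw1 : ∑ x, w x = 1)
    {a : κ → ℝ} (ha : ∀ k, |a k| ≤ C) {g : ι → ℝ} {D : ℝ} (hD : 0 ≤ D) (hg : ∀ x, |g x| ≤ D) :
    Integrable (fun y => gaussLR a y * posteriorMean w u g y) (stdGaussianPi κ) :=
  integrable_of_abs_le_exp ((continuous_gaussLR _).mul (continuous_posteriorMean hw0 hw1 _))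
    (abs_gaussLR_mul_posteriorMean_le hw0 hw1 ha hD hg)

lemma mixLR_le (hw0 : ∀ x, 0 ≤ w x) (hw1 : ∑ x, w x = 1) (hu : ∀ x k, |u x k| ≤ C)
    (y : κ → ℝ) : mixLR w u y ≤ Real.exp (C * ∑ k, |y k|) := by
  calc mixLR w u y ≤ ∑ x, w x * Real.exp (C * ∑ k, |y k|) :=
        Finset.sum_le_sum fun x _ => mul_le_mul_of_nonneg_left (gaussLR_le (hu x) y) (hw0 x)
    _ = _ := by rw [← Finset.sum_mul, hw1, one_mul]

lemma abs_sum_mul_le_sum_const (hC : 0 ≤ C) {v v' : κ → ℝ} (hv : ∀ k, |v k| ≤ C)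
    (hv' : ∀ k, |v' k| ≤ C) : |∑ k, v k * v' k| ≤ ∑ _k : κ, C * C :=
  (Finset.abs_sum_le_sum_abs _ _).trans <| Finset.sum_le_sum fun k _ => by
    rw [abs_mul]
    exact mul_le_mul (hv k) (hv' k) (abs_nonneg _) hC

lemma le_mixLR (hC : 0 ≤ C) (hw0 : ∀ x, 0 ≤ w x) (hw1 : ∑ x, w x = 1)
    (hu : ∀ x k, |u x k| ≤ C) (y : κ → ℝ) :
    Real.exp (-(C * ∑ k, |y k| + ∑ _k : κ, C * C)) ≤ mixLR w u y := by
  calc Real.exp (-(C * ∑ k, |y k| + ∑ _k : κ, C * C))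
      = ∑ x, w x * Real.exp (-(C * ∑ k, |y k| + ∑ _k : κ, C * C)) := by
        rw [← Finset.sum_mul (f := w), hw1, one_mul]
    _ ≤ _ := Finset.sum_le_sum fun x _ => by
      refine mul_le_mul_of_nonneg_left (Real.exp_le_exp.2 ?_) (hw0 x)
      have h1 := (abs_le.1 (abs_sum_mul_le (y := y) (hu x))).1
      have h2 := (abs_le.1 (abs_sum_mul_le_sum_const hC (hu x) (hu x))).2
      have h3 : 0 ≤ ∑ _k : κ, C * C := by positivity
      simp_rw [← sq (u x _)] at h2
      linarith

lemma abs_log_mixLR_le (hC : 0 ≤ C) (hw0 : ∀ x, 0 ≤ w x) (hw1 : ∑ x, w x = 1)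
    (hu : ∀ x k, |u x k| ≤ C) (y : κ → ℝ) :
    |Real.log (mixLR w u y)| ≤ C * ∑ k, |y k| + ∑ _k : κ, C * C := by
  have h3 : 0 ≤ ∑ _k : κ, C * C := by positivity
  rw [abs_le]
  constructor
  · rw [Real.le_log_iff_exp_le (mixLR_pos hw0 hw1 y)]
    exact le_mixLR hC hw0 hw1 hu y
  · have := (Real.log_le_iff_le_exp (mixLR_pos hw0 hw1 y)).2 (mixLR_le hw0 hw1 hu y)
    linarith

/-- A polynomial bound in `∑ k, |y k|` turned into an exponential one. -/
lemma linear_le_exp {C D S : ℝ} (hC : 0 ≤ C) (hD : 0 ≤ D) (hS : 0 ≤ S) :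
    C * S + D ≤ (C + D) * Real.exp S := by
  nlinarith [Real.add_one_le_exp S]

lemma abs_log_mixLR_add_one_le (hC : 0 ≤ C) (hw0 : ∀ x, 0 ≤ w x) (hw1 : ∑ x, w x = 1)
    (hu : ∀ x k, |u x k| ≤ C) (y : κ → ℝ) :
    |Real.log (mixLR w u y) + 1| ≤ (C + (∑ _k : κ, C * C + 1)) * Real.exp (∑ k, |y k|) := by
  refine (abs_add_le _ _).trans (le_trans ?_
    (linear_le_exp hC (by positivity) (by positivity : 0 ≤ ∑ k, |y k|)))
  rw [abs_one, ← add_assoc]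
  exact add_le_add_left (abs_log_mixLR_le hC hw0 hw1 hu y) 1

lemma hasDerivAt_mixLR {u : ℝ → ι → κ → ℝ} {u' : ι → κ → ℝ} {s : ℝ}
    (hu : ∀ x k, HasDerivAt (fun r => u r x k) (u' x k) s) (y : κ → ℝ) :
    HasDerivAt (fun r => mixLR w (u r) y)
      (∑ x, w x * ((∑ k, u' x k * y k - ∑ k, u s x k * u' x k) * gaussLR (u s x) y)) s :=
  HasDerivAt.fun_sum fun x _ => (hasDerivAt_gaussLR (hu x) y).const_mul (w x)

lemma hasDerivAt_gaussLR_line (a v y : κ → ℝ) :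
    HasDerivAt (fun s : ℝ => gaussLR a (y + s • v)) ((∑ k, a k * v k) * gaussLR a y) 0 := by
  have h1 : HasDerivAt (fun s : ℝ => ∑ k, a k * (y + s • v) k) (∑ k, a k * v k) 0 :=
    HasDerivAt.fun_sum fun k _ => by
      simpa using (((hasDerivAt_id (0 : ℝ)).mul_const (v k)).const_add (y k)).const_mul (a k)
  refine ((h1.sub_const ((∑ k, a k ^ 2) / 2)).exp).congr_deriv ?_
  simp [gaussLR, mul_comm]

lemma hasDerivAt_log_mixLR_line (hw0 : ∀ x, 0 ≤ w x) (hw1 : ∑ x, w x = 1) (v y : κ → ℝ) :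
    HasDerivAt (fun s : ℝ => Real.log (mixLR w u (y + s • v)))
      (posteriorMean w u (fun x => ∑ k, u x k * v k) y) 0 := by
  have h : HasDerivAt (fun s : ℝ => mixLR w u (y + s • v))
      (∑ x, w x * ((∑ k, u x k * v k) * gaussLR (u x) y)) 0 :=
    HasDerivAt.fun_sum fun x _ => (hasDerivAt_gaussLR_line (u x) v y).const_mul (w x)
  refine (h.log (by simpa using (mixLR_pos hw0 hw1 y).ne')).congr_deriv ?_
  rw [posteriorMean]
  simp only [zero_smul, add_zero]
  congr 1
  exact Finset.sum_congr rfl fun x _ => by ring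

/-- Gaussian integration by parts for the log-likelihood ratio of the mixture. -/
lemma integral_score_mul_log_mixLR (hC : 0 ≤ C) (hw0 : ∀ x, 0 ≤ w x) (hw1 : ∑ x, w x = 1)
    (hu : ∀ x k, |u x k| ≤ C) {a v : κ → ℝ} (ha : ∀ k, |a k| ≤ C) (hv : ∀ k, |v k| ≤ C) :
    Integrable (fun y => (∑ k, v k * y k - ∑ k, a k * v k) * gaussLR a y
      * (Real.log (mixLR w u y) + 1)) (stdGaussianPi κ) ∧
    ∫ y, (∑ k, v k * y k - ∑ k, a k * v k) * gaussLR a y * (Real.log (mixLR w u y) + 1)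
        ∂(stdGaussianPi κ)
      = ∫ y, gaussLR a y * posteriorMean w u (fun x => ∑ k, u x k * v k) y
        ∂(stdGaussianPi κ) := by
  set D : ℝ := ∑ _k : κ, C * C
  have hD : 0 ≤ D := by positivity
  have hlog := continuous_log_mixLR (u := u) hw0 hw1
  have hpost := continuous_posteriorMean (u := u) hw0 hw1 (fun x => ∑ k, u x k * v k)
  have hav := abs_sum_mul_le_sum_const hC ha hv
  have hbase : ∀ y : κ → ℝ, |gaussLR a y * (Real.log (mixLR w u y) + 1)|
      ≤ (C + (D + 1)) * Real.exp ((C + 1) * ∑ k, |y k|) := fun y => by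
    rw [abs_mul, abs_of_pos (gaussLR_pos _ _), add_mul C 1, one_mul, Real.exp_add, mul_left_comm]
    exact mul_le_mul (gaussLR_le ha y) (abs_log_mixLR_add_one_le hC hw0 hw1 hu y) (abs_nonneg _)
      (Real.exp_pos _).le
  have hI : Integrable (fun y => gaussLR a y * (Real.log (mixLR w u y) + 1))
      (stdGaussianPi κ) := integrable_of_abs_le_exp (by fun_prop) hbase
  have hlin : Integrable (fun y => (∑ k, v k * y k) *
      (gaussLR a y * (Real.log (mixLR w u y) + 1))) (stdGaussianPi κ) := by
    refine integrable_of_abs_le_exp (A := C * (C + (D + 1))) (B := C + 2) (by fun_prop) fun y => ?_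
    have h1 : |∑ k, v k * y k| ≤ C * Real.exp (∑ k, |y k|) := (abs_sum_mul_le hv).trans
      (mul_le_mul_of_nonneg_left (by linarith [Real.add_one_le_exp (∑ k, |y k|)]) hC)
    rw [abs_mul, (by ring : (C + 2) * ∑ k, |y k| = ∑ k, |y k| + (C + 1) * ∑ k, |y k|),
      Real.exp_add, mul_mul_mul_comm]
    exact mul_le_mul h1 (hbase y) (abs_nonneg _) (by positivity)
  have hgD : ∀ x, |∑ k, u x k * v k| ≤ D := fun x => abs_sum_mul_le_sum_const hC (hu x) hv
  have hP := integrable_gaussLR_mul_posteriorMean (u := u) hw0 hw1 ha hD hgD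
  have hstein := integral_linear_mul_eq_integral_deriv (v := v)
    (f := fun y => gaussLR a y * (Real.log (mixLR w u y) + 1))
    (f' := fun y => (∑ k, a k * v k) * gaussLR a y * (Real.log (mixLR w u y) + 1)
      + gaussLR a y * posteriorMean w u (fun x => ∑ k, u x k * v k) y)
    (A := (D + 1) * (C + (D + 1))) (B := C + 1) (by fun_prop) (by fun_prop)
    (fun y => by
      simpa using! (hasDerivAt_gaussLR_line a v y).mul
        ((hasDerivAt_log_mixLR_line (u := u) hw0 hw1 v y).add_const 1))
    (by positivity)
    (fun y => (hbase y).trans (by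
      have : 0 ≤ (C + (D + 1)) * Real.exp ((C + 1) * ∑ k, |y k|) := by positivity
      nlinarith))
    (fun y => by
      refine (abs_add_le _ _).trans ?_
      rw [mul_assoc (∑ k, a k * v k), abs_mul]
      have h1 := mul_le_mul hav (hbase y) (abs_nonneg _) hD
      have h2 := abs_gaussLR_mul_posteriorMean_le (u := u) hw0 hw1 ha hD hgD y
      have h3 : Real.exp (C * ∑ k, |y k|) ≤ Real.exp ((C + 1) * ∑ k, |y k|) := by
        gcongr
        linarith
      have h4 := Real.exp_pos ((C + 1) * ∑ k, |y k|)
      nlinarith [mul_le_mul_of_nonneg_right h3 hD, mul_nonneg hC h4.le])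
  have hrw : ∀ y, (∑ k, v k * y k - ∑ k, a k * v k) * gaussLR a y * (Real.log (mixLR w u y) + 1)
      = (∑ k, v k * y k) * (gaussLR a y * (Real.log (mixLR w u y) + 1))
        - (∑ k, a k * v k) * (gaussLR a y * (Real.log (mixLR w u y) + 1)) := fun y => by ring
  simp_rw [hrw]
  refine ⟨hlin.sub (hI.const_mul _), ?_⟩
  rw [integral_sub hlin (hI.const_mul _), hstein]
  simp_rw [mul_assoc]
  rw [integral_add (hI.const_mul _) hP, add_sub_cancel_left]

/-- Differentiation of the relative entropy of a smoothly moving Gaussian mixture. -/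
lemma hasDerivAt_integral_mixLR_mul_log {u u' : ℝ → ι → κ → ℝ} {t ε : ℝ} (hε : 0 < ε)
    (hC : 0 ≤ C) (hw0 : ∀ x, 0 ≤ w x) (hw1 : ∑ x, w x = 1)
    (hd : ∀ s ∈ Metric.ball t ε, ∀ x k, HasDerivAt (fun r => u r x k) (u' s x k) s)
    (hu : ∀ s ∈ Metric.ball t ε, ∀ x k, |u s x k| ≤ C)
    (hu' : ∀ s ∈ Metric.ball t ε, ∀ x k, |u' s x k| ≤ C) :
    HasDerivAt (fun s => ∫ y, mixLR w (u s) y * Real.log (mixLR w (u s) y) ∂(stdGaussianPi κ))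
      (∫ y, ∑ x, w x * (gaussLR (u t x) y *
        posteriorMean w (u t) (fun x' => ∑ k, u t x' k * u' t x k) y) ∂(stdGaussianPi κ)) t := by
  set D : ℝ := ∑ _k : κ, C * C
  have hD : 0 ≤ D := by positivity
  have ht : t ∈ Metric.ball t ε := Metric.mem_ball_self hε
  have hlog : ∀ s, Continuous fun y => Real.log (mixLR w (u s) y) := fun s =>
    continuous_log_mixLR hw0 hw1
  have hlogt := hlog t
  have hmain := hasDerivAt_integral_of_dominated_loc_of_deriv_le (μ := stdGaussianPi κ)
    (F := fun s y => mixLR w (u s) y * Real.log (mixLR w (u s) y))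
    (F' := fun s y => ∑ x, w x * ((∑ k, u' s x k * y k - ∑ k, u s x k * u' s x k)
      * gaussLR (u s x) y * (Real.log (mixLR w (u s) y) + 1)))
    (bound := fun y => (C + D) * (C + (D + 1)) * Real.exp ((C + 2) * ∑ k, |y k|))
    (Metric.ball_mem_nhds t hε)
    (.of_forall fun s => (continuous_mixLR.mul (hlog s)).aestronglyMeasurable)
    (by
      refine integrable_of_abs_le_exp (A := C + D) (B := C + 1)
        (continuous_mixLR.mul (hlog t)) fun y => ?_
      rw [abs_mul, abs_of_pos (mixLR_pos hw0 hw1 y), add_mul C 1, one_mul, Real.exp_add,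
        mul_left_comm]
      exact mul_le_mul (mixLR_le hw0 hw1 (hu t ht) y)
        ((abs_log_mixLR_le hC hw0 hw1 (hu t ht) y).trans (linear_le_exp hC hD (by positivity)))
        (abs_nonneg _) (Real.exp_pos _).le)
    (by fun_prop : Continuous _).aestronglyMeasurable
    (.of_forall fun y s hs => by
      rw [Real.norm_eq_abs]
      have hS : 0 ≤ ∑ k, |y k| := by positivity
      have hx : ∀ x, |(∑ k, u' s x k * y k - ∑ k, u s x k * u' s x k)
          * gaussLR (u s x) y * (Real.log (mixLR w (u s) y) + 1)|
          ≤ (C + D) * (C + (D + 1)) * Real.exp ((C + 2) * ∑ k, |y k|) := fun x => by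
        rw [abs_mul, abs_mul, abs_of_pos (gaussLR_pos _ _)]
        calc _ ≤ ((C + D) * Real.exp (∑ k, |y k|)) * Real.exp (C * ∑ k, |y k|)
              * ((C + (D + 1)) * Real.exp (∑ k, |y k|)) := by
              gcongr
              · exact (gaussLR_pos _ _).le
              · exact (abs_sub _ _).trans ((add_le_add (abs_sum_mul_le (hu' s hs x))
                  (abs_sum_mul_le_sum_const hC (hu s hs x) (hu' s hs x))).trans
                  (linear_le_exp hC hD hS))
              · exact gaussLR_le (hu s hs x) y
              · exact abs_log_mixLR_add_one_le hC hw0 hw1 (hu s hs) y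
          _ = _ := by
            rw [(by ring : (C + 2) * ∑ k, |y k| = ∑ k, |y k| + C * ∑ k, |y k| + ∑ k, |y k|),
              Real.exp_add, Real.exp_add]
            ring
      calc _ ≤ ∑ x, w x * ((C + D) * (C + (D + 1)) * Real.exp ((C + 2) * ∑ k, |y k|)) := by
            refine (Finset.abs_sum_le_sum_abs _ _).trans (Finset.sum_le_sum fun x _ => ?_)
            rw [abs_mul, abs_of_nonneg (hw0 x)]
            exact mul_le_mul_of_nonneg_left (hx x) (hw0 x)
        _ = _ := by rw [← Finset.sum_mul, hw1, one_mul])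
    ((integrable_exp_sum_abs _).const_mul _)
    (.of_forall fun y s hs => by
      have hZ := hasDerivAt_mixLR (w := w) (hd s hs) y
      have hZ0 := (mixLR_pos (u := u s) hw0 hw1 y).ne'
      refine (hZ.mul (hZ.log hZ0)).congr_deriv ?_
      rw [mul_div_cancel₀ _ hZ0, ← mul_add_one, Finset.sum_mul]
      exact Finset.sum_congr rfl fun x _ => by ring)
  refine hmain.2.congr_deriv ?_
  have hparts := fun x => integral_score_mul_log_mixLR hC hw0 hw1 (hu t ht) (hu t ht x) (hu' t ht x)
  rw [integral_finsetSum _ fun x _ => (hparts x).1.const_mul _, integral_finsetSum]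
  · refine Finset.sum_congr rfl fun x _ => ?_
    rw [integral_const_mul, integral_const_mul, (hparts x).2]
  · intro x _
    exact (integrable_gaussLR_mul_posteriorMean hw0 hw1 (hu t ht x) hD
      fun x' => abs_sum_mul_le_sum_const hC (hu t ht x') (hu' t ht x)).const_mul _

end GaussianMixture

section FiniteSupport

variable {α : Type*} [MeasurableSpace α] [MeasurableSingletonClass α] {μ : Measure α}
  [IsFiniteMeasure μ] {T : Finset α}

lemma integrable_of_ae_mem_finset (hT : ∀ᵐ x ∂μ, x ∈ (T : Set α)) (f : α → ℝ) :
    Integrable f μ := by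
  have h : IntegrableOn f T μ := IntegrableOn.finset
  rwa [IntegrableOn, Measure.restrict_eq_self_of_ae_mem hT] at h

lemma integral_of_ae_mem_finset (hT : ∀ᵐ x ∂μ, x ∈ (T : Set α)) (f : α → ℝ) :
    ∫ x, f x ∂μ = ∑ x : T, μ.real {(x : α)} * f x := by
  have h := setIntegral_finset (μ := μ) (f := f) T IntegrableOn.finset
  rw [Measure.restrict_eq_self_of_ae_mem hT] at h
  rw [h, Finset.sum_coe_sort T fun x => μ.real {x} * f x]
  simp

end FiniteSupport

section Channel

variable {n : ℕ}

/-- The signal of a configuration `x` in the Gaussian channel observing its pairwise products with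
amplitude `a` and its coordinates with amplitude `b`. -/
def channel (a b : ℝ) (x : Fin n → ℝ) : SymIdx n ⊕ Fin n → ℝ :=
  Sum.elim (fun q => a * (x q.1.1 * x q.1.2)) fun i => b * x i

lemma hasDerivAt_channel {a b : ℝ → ℝ} {a' b' s : ℝ} (ha : HasDerivAt a a' s)
    (hb : HasDerivAt b b' s) (x : Fin n → ℝ) (k : SymIdx n ⊕ Fin n) :
    HasDerivAt (fun r => channel (a r) (b r) x k) (channel a' b' x k) s := by
  rcases k with q | i
  · exact ha.mul_const _
  · exact hb.mul_const _

lemma abs_channel_le {a b c : ℝ} (ha : |a| ≤ c) (hb : |b| ≤ c) (x : Fin n → ℝ)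
    (k : SymIdx n ⊕ Fin n) : |channel a b x k| ≤ c * |channel 1 1 x k| := by
  rcases k with q | i
  · simpa [channel, abs_mul] using mul_le_mul_of_nonneg_right ha (by positivity)
  · simpa [channel, abs_mul] using mul_le_mul_of_nonneg_right hb (by positivity)

lemma sum_channel_mul (a b a' b' : ℝ) (x x' : Fin n → ℝ) :
    ∑ k, channel a b x k * channel a' b' x' k
      = a * a' * ∑ q : SymIdx n, (x q.1.1 * x' q.1.1) * (x q.1.2 * x' q.1.2)
        + b * b' * ∑ i, x i * x' i := by
  simp only [Fintype.sum_sum_type, channel, Sum.elim_inl, Sum.elim_inr, Finset.mul_sum]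
  congr 1 <;> exact Finset.sum_congr rfl fun _ _ => by ring

lemma sq_sum_le_two_mul_sum_symIdx (f : Fin n → ℝ) :
    (∑ i, f i) ^ 2 ≤ 2 * ∑ q : SymIdx n, f q.1.1 * f q.1.2 := by
  have h1 : ∑ q : SymIdx n, f q.1.1 * f q.1.2
      = ∑ i, ∑ j, if i ≤ j then f i * f j else 0 := by
    rw [← Fintype.sum_prod_type' (f := fun i j => if i ≤ j then f i * f j else 0),
      ← Finset.sum_filter]
    exact (Finset.sum_subtype _ (by simp) fun q : Fin n × Fin n => f q.1 * f q.2).symm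
  have h2 : ∑ q : SymIdx n, f q.1.1 * f q.1.2
      = ∑ i, ∑ j, if j ≤ i then f i * f j else 0 := by
    rw [h1, Finset.sum_comm]
    exact Finset.sum_congr rfl fun i _ => Finset.sum_congr rfl fun j _ => by rw [mul_comm]
  rw [two_mul]
  nth_rewrite 1 [h1]
  rw [h2, sq, Finset.sum_mul_sum, ← Finset.sum_add_distrib]
  refine Finset.sum_le_sum fun i _ => ?_
  rw [← Finset.sum_add_distrib]
  refine Finset.sum_le_sum fun j _ => ?_
  rcases lt_trichotomy i j with h | h | h
  · simp [h.le, h.not_ge]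
  · subst h
    simp [mul_self_nonneg]
  · simp [h.le, h.not_ge]

/-- The overlap kernel is bounded below by completing the square. -/
lemma neg_le_sum_channel_mul {Δ m a b a' b' : ℝ} (hΔ : 0 < Δ) (hn : 1 ≤ n)
    (haa : a * a' = 1 / (2 * (n * Δ))) (hbb : b * b' = -(m / (2 * Δ))) (x x' : Fin n → ℝ) :
    -(n * (m ^ 2 / (4 * Δ))) ≤ ∑ k, channel a b x k * channel a' b' x' k := by
  rw [sum_channel_mul, haa, hbb]
  have h := sq_sum_le_two_mul_sum_symIdx fun i => x i * x' i
  set R := ∑ i, x i * x' i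
  set Q := ∑ q : SymIdx n, (x q.1.1 * x' q.1.1) * (x q.1.2 * x' q.1.2)
  have hn0 : (0 : ℝ) < n := by exact_mod_cast hn
  have key : 1 / (2 * (n * Δ)) * Q + -(m / (2 * Δ)) * R + n * (m ^ 2 / (4 * Δ))
      = ((2 * Q - R ^ 2) + (R - n * m) ^ 2) / (4 * n * Δ) := by
    field_simp
    ring
  have : 0 ≤ ((2 * Q - R ^ 2) + (R - n * m) ^ 2) / (4 * n * Δ) := by
    have := sq_nonneg (R - n * m)
    have : 0 ≤ 2 * Q - R ^ 2 := by linarith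
    positivity
  linarith

lemma exp_ham_eq_gaussLR {Δ m t : ℝ} (hΔ : 0 < Δ) (hm : 0 ≤ m) (ht : t ∈ Set.Ioo (0 : ℝ) 1)
    (xs : Fin n → ℝ) (ξ : SymIdx n → ℝ) (z x : Fin n → ℝ) :
    Real.exp (Ham Δ m n t xs ξ z x)
      = gaussLR (channel √(t / (n * Δ)) √(m * (1 - t) / Δ) x)
        (Sum.elim ξ z + channel √(t / (n * Δ)) √(m * (1 - t) / Δ) xs) := by
  have ha : √(t / (n * Δ)) ^ 2 = t / (n * Δ) :=
    Real.sq_sqrt (div_nonneg ht.1.le (by positivity))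
  have hb : √(m * (1 - t) / Δ) ^ 2 = m * (1 - t) / Δ :=
    Real.sq_sqrt (div_nonneg (mul_nonneg hm (by linarith [ht.2])) hΔ.le)
  have hb' : (1 - t) * m * (∑ i, x i ^ 2) / (2 * Δ)
      = ∑ i, √(m * (1 - t) / Δ) ^ 2 * x i ^ 2 / 2 := by
    rw [hb, ← Finset.sum_div, ← Finset.mul_sum]; field_simp
  have hb'' : (1 - t) * m * (∑ i, x i * xs i) / Δ
      = ∑ i, √(m * (1 - t) / Δ) ^ 2 * (x i * xs i) := by
    rw [hb, ← Finset.mul_sum]; ring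
  rw [gaussLR, Ham, hb', hb'']
  congr 1
  simp only [Fintype.sum_sum_type, channel, Sum.elim_inl, Sum.elim_inr, Pi.add_apply]
  generalize √(m * (1 - t) / Δ) = b
  generalize √(t / (n * Δ)) = a at ha ⊢
  have hpairs : ∑ q : SymIdx n, (-(t * x q.1.1 ^ 2 * x q.1.2 ^ 2) / (2 * Δ * n)
        + t * x q.1.1 * x q.1.2 * xs q.1.1 * xs q.1.2 / (Δ * n) + a * x q.1.1 * x q.1.2 * ξ q)
      = ∑ q : SymIdx n, a * (x q.1.1 * x q.1.2) * (ξ q + a * (xs q.1.1 * xs q.1.2))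
        - (∑ q : SymIdx n, (a * (x q.1.1 * x q.1.2)) ^ 2) / 2 := by
    rw [Finset.sum_div, ← Finset.sum_sub_distrib]
    refine Finset.sum_congr rfl fun q _ => ?_
    linear_combination
      ((x q.1.1 * x q.1.2) ^ 2 / 2 - x q.1.1 * x q.1.2 * (xs q.1.1 * xs q.1.2)) * ha
  have hcoords : ∑ i, b * x i * (z i + b * xs i) - (∑ i, (b * x i) ^ 2) / 2
      = -∑ i, b ^ 2 * x i ^ 2 / 2 + ∑ i, b ^ 2 * (x i * xs i) + b * ∑ i, x i * z i := by
    rw [Finset.sum_div, Finset.mul_sum, ← Finset.sum_sub_distrib, ← Finset.sum_neg_distrib,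
      ← Finset.sum_add_distrib, ← Finset.sum_add_distrib]
    exact Finset.sum_congr rfl fun i _ => by ring
  linear_combination hpairs - hcoords

end Channel

section Interpolation

variable {κ ι : Type*} [Fintype κ] [Fintype ι] {w : ι → ℝ} {u : ι → κ → ℝ} {C : ℝ}

lemma integrable_log_mixLR_add (hC : 0 ≤ C) (hw0 : ∀ x, 0 ≤ w x) (hw1 : ∑ x, w x = 1)
    (hu : ∀ x k, |u x k| ≤ C) (v : κ → ℝ) :
    Integrable (fun y => Real.log (mixLR w u (y + v))) (stdGaussianPi κ) := by
  refine integrable_of_abs_le_exp (A := C + (C * ∑ k, |v k| + ∑ _k : κ, C * C)) (B := 1)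
    ((continuous_log_mixLR hw0 hw1).comp (by fun_prop)) fun y => ?_
  rw [one_mul]
  refine (abs_log_mixLR_le hC hw0 hw1 hu _).trans (le_trans ?_
    (linear_le_exp hC (by positivity) (by positivity : 0 ≤ ∑ k, |y k|)))
  rw [← add_assoc, ← mul_add, ← Finset.sum_add_distrib]
  gcongr with k
  exact abs_add_le _ _

lemma sum_integral_log_mixLR_add (hC : 0 ≤ C) (hw0 : ∀ x, 0 ≤ w x) (hw1 : ∑ x, w x = 1)
    (hu : ∀ x k, |u x k| ≤ C) :
    ∑ x, w x * ∫ y, Real.log (mixLR w u (y + u x)) ∂(stdGaussianPi κ)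
      = ∫ y, mixLR w u y * Real.log (mixLR w u y) ∂(stdGaussianPi κ) := by
  have hint : ∀ x, Integrable (fun y => gaussLR (u x) y * Real.log (mixLR w u y))
      (stdGaussianPi κ) := fun x => by
    refine integrable_of_abs_le_exp (A := C + ∑ _k : κ, C * C) (B := C + 1)
      ((continuous_gaussLR _).mul (continuous_log_mixLR hw0 hw1)) fun y => ?_
    rw [abs_mul, abs_of_pos (gaussLR_pos _ _), add_mul C 1, one_mul, Real.exp_add, mul_left_comm]
    exact mul_le_mul (gaussLR_le (hu x) y) ((abs_log_mixLR_le hC hw0 hw1 hu y).trans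
      (linear_le_exp hC (by positivity) (by positivity))) (abs_nonneg _) (Real.exp_pos _).le
  have hexpand : ∀ y, mixLR w u y * Real.log (mixLR w u y)
      = ∑ x, w x * (gaussLR (u x) y * Real.log (mixLR w u y)) := fun y => by
    simp_rw [← mul_assoc]
    rw [← Finset.sum_mul, ← mixLR]
  simp_rw [hexpand]
  rw [integral_finsetSum _ fun x _ => (hint x).const_mul _]
  refine Finset.sum_congr rfl fun x _ => ?_
  rw [integral_const_mul, ← integral_stdGaussianPi_add]

lemma neg_le_integral_posteriorMean (hw0 : ∀ x, 0 ≤ w x) (hw1 : ∑ x, w x = 1)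
    (hu : ∀ x k, |u x k| ≤ C) {g : ι → ι → ℝ} {B D : ℝ} (hD : 0 ≤ D)
    (hg : ∀ x x', |g x x'| ≤ D) (hB : ∀ x x', B ≤ g x x') :
    B ≤ ∫ y, ∑ x, w x * (gaussLR (u x) y * posteriorMean w u (g x) y) ∂(stdGaussianPi κ) := by
  have hint : ∀ x, Integrable (fun y => gaussLR (u x) y * posteriorMean w u (g x) y)
      (stdGaussianPi κ) := fun x =>
    integrable_gaussLR_mul_posteriorMean hw0 hw1 (hu x) hD (hg x)
  have hLR : ∀ x, Integrable (gaussLR (u x)) (stdGaussianPi κ) := fun x =>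
    integrable_of_abs_le_exp (A := 1) (continuous_gaussLR _) fun y => by
      rw [abs_of_pos (gaussLR_pos _ _), one_mul]
      exact gaussLR_le (hu x) y
  rw [integral_finsetSum _ fun x _ => (hint x).const_mul _]
  calc B = ∑ x, w x * B := by rw [← Finset.sum_mul, hw1, one_mul]
    _ ≤ _ := Finset.sum_le_sum fun x _ => ?_
  rw [integral_const_mul]
  refine mul_le_mul_of_nonneg_left ?_ (hw0 x)
  calc B = ∫ y, gaussLR (u x) y * B ∂(stdGaussianPi κ) := by
        rw [integral_mul_const, integral_gaussLR, one_mul]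
    _ ≤ _ := integral_mono ((hLR x).mul_const _) (hint x) fun y => by
      refine mul_le_mul_of_nonneg_left ?_ (gaussLR_pos _ _).le
      rw [posteriorMean, le_div_iff₀ (mixLR_pos hw0 hw1 y), mixLR, Finset.mul_sum]
      refine Finset.sum_le_sum fun x' _ => ?_
      rw [mul_comm]
      exact mul_le_mul_of_nonneg_left (hB x x') (mul_nonneg (hw0 x') (gaussLR_pos _ _).le)

variable {p : Measure ℝ} [IsProbabilityMeasure p] {Δ m : ℝ} {n : ℕ} {T : Finset (Fin n → ℝ)}

/-- The averaged log-partition function is the relative entropy of the Gaussian mixture observed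
through the channel with respect to the pure noise. -/
lemma favg_eq_integral_mixLR (hΔ : 0 < Δ) (hm : 0 ≤ m)
    (hT : ∀ᵐ x ∂(Measure.pi fun _ : Fin n => p), x ∈ (T : Set (Fin n → ℝ)))
    (hw1 : ∑ x : T, (Measure.pi fun _ : Fin n => p).real {(x : Fin n → ℝ)} = 1)
    {t : ℝ} (ht : t ∈ Set.Ioo (0 : ℝ) 1) :
    Favg p Δ m n t
      = ∫ y, mixLR (fun x : T => (Measure.pi fun _ : Fin n => p).real {(x : Fin n → ℝ)})
          (fun x => channel √(t / (n * Δ)) √(m * (1 - t) / Δ) x.1) y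
        * Real.log (mixLR (fun x : T => (Measure.pi fun _ : Fin n => p).real {(x : Fin n → ℝ)})
          (fun x => channel √(t / (n * Δ)) √(m * (1 - t) / Δ) x.1) y)
        ∂(stdGaussianPi (SymIdx n ⊕ Fin n)) := by
  set μ : Measure (Fin n → ℝ) := Measure.pi fun _ : Fin n => p
  set w : T → ℝ := fun x => μ.real {(x : Fin n → ℝ)}
  set u : T → SymIdx n ⊕ Fin n → ℝ :=
    fun x => channel √(t / (n * Δ)) √(m * (1 - t) / Δ) x.1
  have hw0 : ∀ x, 0 ≤ w x := fun x => measureReal_nonneg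
  obtain ⟨C, hC, hu⟩ : ∃ C : ℝ, 0 ≤ C ∧ ∀ x k, |u x k| ≤ C :=
    ⟨∑ x, ∑ k, |u x k|, by positivity, fun x k =>
      (Finset.single_le_sum (f := fun k => |u x k|) (fun _ _ => abs_nonneg _)
        (Finset.mem_univ k)).trans (Finset.single_le_sum (f := fun x => ∑ k, |u x k|)
        (fun _ _ => by positivity) (Finset.mem_univ x))⟩
  have hZsum : ∀ xs ξ z, Zt p Δ m n t xs ξ z
      = ∑ x : T, w x * Real.exp (Ham Δ m n t xs ξ z x) := fun xs ξ z =>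
    integral_of_ae_mem_finset hT _
  have hZ : ∀ xs ξ z, Zt p Δ m n t xs ξ z
      = mixLR w u (Sum.elim ξ z + channel √(t / (n * Δ)) √(m * (1 - t) / Δ) xs) :=
    fun xs ξ z => by
      rw [hZsum]
      exact Finset.sum_congr rfl fun x _ => by rw [exp_ham_eq_gaussLR hΔ hm ht]
  have hcont : Continuous fun ω : (Fin n → ℝ) × (SymIdx n → ℝ) × (Fin n → ℝ) =>
      Real.log (Zt p Δ m n t ω.1 ω.2.1 ω.2.2) := by
    refine Continuous.log ?_ fun ω => ?_
    · simp_rw [hZsum, Ham]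
      fun_prop
    · rw [hZ]
      exact (mixLR_pos hw0 hw1 _).ne'
  let e := MeasurableEquiv.sumPiEquivProdPi fun _ : SymIdx n ⊕ Fin n => ℝ
  have he : MeasurePreserving e (stdGaussianPi (SymIdx n ⊕ Fin n))
      ((stdGaussianPi (SymIdx n)).prod (stdGaussianPi (Fin n))) :=
    measurePreserving_sumPiEquivProdPi fun _ => gaussianReal 0 1
  have helim : ∀ y, Sum.elim (e y).1 (e y).2 = y := fun y => by
    ext (q | i) <;> rfl
  have hsec : ∀ xs, Integrable (fun η : (SymIdx n → ℝ) × (Fin n → ℝ) =>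
      Real.log (Zt p Δ m n t xs η.1 η.2))
      ((stdGaussianPi (SymIdx n)).prod (stdGaussianPi (Fin n))) := fun xs => by
    rw [← he.integrable_comp_emb e.measurableEmbedding]
    simp only [Function.comp_def, hZ, helim]
    exact integrable_log_mixLR_add hC hw0 hw1 hu _
  have hint : Integrable (fun ω : (Fin n → ℝ) × (SymIdx n → ℝ) × (Fin n → ℝ) =>
      Real.log (Zt p Δ m n t ω.1 ω.2.1 ω.2.2)) (baseP p n) :=
    (integrable_prod_iff hcont.aestronglyMeasurable).2
      ⟨.of_forall hsec, integrable_of_ae_mem_finset hT _⟩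
  rw [← sum_integral_log_mixLR_add hC hw0 hw1 hu, Favg]
  refine (integral_prod _ hint).trans ?_
  rw [integral_of_ae_mem_finset hT]
  refine Finset.sum_congr rfl fun x _ => ?_
  congr 1
  refine (he.integral_comp e.measurableEmbedding _).symm.trans ?_
  simp only [hZ, helim]
  rfl

end Interpolation

/-- **Key interpolation lemma** : for every `n ≥ 1` and `t ∈ (0,1)`, `t ↦ E[log Z_t]`
is differentiable and `(1/n) (d/dt) E[log Z_t] ≥ −m²/(4Δ)`. -/
theorem interpolation_derivative_lower_bound
    (p : Measure ℝ) [IsProbabilityMeasure p]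
    (hsupp : ∃ s : Finset ℝ, p (↑s : Set ℝ)ᶜ = 0)
    (Δ : ℝ) (hΔ : 0 < Δ) (m : ℝ) (hm : 0 ≤ m)
    (n : ℕ) (hn : 1 ≤ n) (t : ℝ) (ht : t ∈ Set.Ioo (0 : ℝ) 1) :
    DifferentiableAt ℝ (Favg p Δ m n) t ∧
      -(m ^ 2 / (4 * Δ)) ≤ (1 / n) * deriv (Favg p Δ m n) t := by
  classical
  obtain ⟨S, hS⟩ := hsupp
  have hn0 : (0 : ℝ) < n := by exact_mod_cast hn
  set μ : Measure (Fin n → ℝ) := Measure.pi fun _ : Fin n => p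
  let T : Finset (Fin n → ℝ) := Fintype.piFinset fun _ => S
  have hT : ∀ᵐ x ∂μ, x ∈ (T : Set (Fin n → ℝ)) := by
    have h : ∀ᵐ x ∂μ, ∀ i, x i ∈ (S : Set ℝ) := eventually_all.2 fun i =>
      Measure.tendsto_eval_ae_ae.eventually (mem_ae_iff.2 hS)
    filter_upwards [h] with x hx
    simpa [T] using hx
  let w : T → ℝ := fun x => μ.real {(x : Fin n → ℝ)}
  have hw0 : ∀ x, 0 ≤ w x := fun x => measureReal_nonneg
  have hw1 : ∑ x, w x = 1 := by
    simpa [w] using (integral_of_ae_mem_finset hT fun _ => 1).symm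
  let a : ℝ → ℝ := fun s => √(s / (n * Δ))
  let b : ℝ → ℝ := fun s => √(m * (1 - s) / Δ)
  let a' : ℝ → ℝ := fun s => 1 / (n * Δ) / (2 * √(s / (n * Δ)))
  let b' : ℝ → ℝ := fun s => √(m / Δ) * (-1 / (2 * √(1 - s)))
  have hb_eq : b = fun s => √(m / Δ) * √(1 - s) := by
    funext s
    rw [← Real.sqrt_mul (by positivity)]
    simp only [b]
    ring_nf
  have hda : ∀ s ∈ Set.Ioo (0 : ℝ) 1, HasDerivAt a (a' s) s := fun s hs =>
    ((hasDerivAt_id s).div_const _).sqrt (div_pos hs.1 (by positivity)).ne'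
  have hdb : ∀ s ∈ Set.Ioo (0 : ℝ) 1, HasDerivAt b (b' s) s := fun s hs => by
    rw [hb_eq]
    exact (((hasDerivAt_id s).const_sub 1).sqrt (by simpa using (sub_pos.2 hs.2).ne')).const_mul _
  have hat : 0 < √(t / (n * Δ)) := Real.sqrt_pos.2 (div_pos ht.1 (by positivity))
  have hbt : 0 < √(1 - t) := Real.sqrt_pos.2 (sub_pos.2 ht.2)
  have haa : a t * a' t = 1 / (2 * (n * Δ)) := by
    simp only [a, a']
    field_simp
  have hbb : b t * b' t = -(m / (2 * Δ)) := by
    have h := Real.mul_self_sqrt (by positivity : 0 ≤ m / Δ)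
    have : b t * b' t = √(m / Δ) * √(m / Δ) * (-1 / 2) := by
      rw [hb_eq]
      simp only [b']
      field_simp
    rw [this, h]
    field_simp
  have hca' : ContinuousAt a' t := by
    refine continuousAt_const.div (by fun_prop) (by positivity)
  have hcb' : ContinuousAt b' t :=
    continuousAt_const.mul (continuousAt_const.div (by fun_prop) (by positivity))
  obtain ⟨c, hc⟩ : ∃ c : ℝ, |a t| < c ∧ |b t| < c ∧ |a' t| < c ∧ |b' t| < c :=
    ⟨|a t| + |b t| + |a' t| + |b' t| + 1, by
      have := abs_nonneg (a t)
      have := abs_nonneg (b t)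
      have := abs_nonneg (a' t)
      have := abs_nonneg (b' t)
      refine ⟨?_, ?_, ?_, ?_⟩ <;> linarith⟩
  have hnhds : ∀ᶠ s in nhds t, s ∈ Set.Ioo (0 : ℝ) 1 ∧ |a s| < c ∧ |b s| < c ∧ |a' s| < c ∧
      |b' s| < c :=
    (isOpen_Ioo.eventually_mem ht).and <|
      ((hda t ht).continuousAt.abs.eventually_lt_const hc.1).and <|
      ((hdb t ht).continuousAt.abs.eventually_lt_const hc.2.1).and <|
      (hca'.abs.eventually_lt_const hc.2.2.1).and (hcb'.abs.eventually_lt_const hc.2.2.2)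
  obtain ⟨ε, hε, hball⟩ := Metric.eventually_nhds_iff_ball.1 hnhds
  have hc0 : 0 ≤ c := (abs_nonneg _).trans hc.1.le
  let M : ℝ := ∑ x : T, ∑ k, |channel 1 1 x.1 k|
  have hM : ∀ (x : T) k, |channel 1 1 x.1 k| ≤ M := fun x k =>
    (Finset.single_le_sum (f := fun k => |channel 1 1 x.1 k|) (fun _ _ => abs_nonneg _)
      (Finset.mem_univ k)).trans (Finset.single_le_sum
      (f := fun x : T => ∑ k, |channel 1 1 x.1 k|) (fun _ _ => by positivity) (Finset.mem_univ x))
  have hM0 : 0 ≤ M := by positivity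
  have hu : ∀ s ∈ Metric.ball t ε, ∀ (x : T) k, |channel (a s) (b s) x.1 k| ≤ c * M :=
    fun s hs x k => (abs_channel_le (hball s hs).2.1.le (hball s hs).2.2.1.le _ _).trans
      (mul_le_mul_of_nonneg_left (hM x k) hc0)
  have hu' : ∀ s ∈ Metric.ball t ε, ∀ (x : T) k, |channel (a' s) (b' s) x.1 k| ≤ c * M :=
    fun s hs x k =>
      (abs_channel_le (hball s hs).2.2.2.1.le (hball s hs).2.2.2.2.le _ _).trans
      (mul_le_mul_of_nonneg_left (hM x k) hc0)
  have hC : 0 ≤ c * M := by positivity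
  have hder := hasDerivAt_integral_mixLR_mul_log (w := w)
    (u := fun s x => channel (a s) (b s) x.1) (u' := fun s x => channel (a' s) (b' s) x.1)
    hε hC hw0 hw1
    (fun s hs x k => hasDerivAt_channel (hda s (hball s hs).1) (hdb s (hball s hs).1) _ _) hu hu'
  have hF : HasDerivAt (Favg p Δ m n) _ t := hder.congr_of_eventuallyEq <| by
    filter_upwards [isOpen_Ioo.eventually_mem ht] with s hs
    exact favg_eq_integral_mixLR hΔ hm hT hw1 hs
  refine ⟨hF.differentiableAt, ?_⟩
  have ht' := Metric.mem_ball_self (x := t) hε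
  have hbound := neg_le_integral_posteriorMean hw0 hw1 (hu t ht')
    (g := fun x x' => ∑ k, channel (a t) (b t) x'.1 k * channel (a' t) (b' t) x.1 k)
    (by positivity : 0 ≤ ∑ _k : SymIdx n ⊕ Fin n, c * M * (c * M))
    (fun x x' => abs_sum_mul_le_sum_const hC (hu t ht' x') (hu' t ht' x))
    (fun x x' => neg_le_sum_channel_mul hΔ hn haa hbb x'.1 x.1)
  rw [hF.deriv, one_div, ← div_eq_inv_mul, le_div_iff₀ hn0]
  linarith
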